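/- For any subsets M ⊆ T ⊆ [n], the double sum over R ⊆ T\M and S with M ⊆ S ⊆ M ∪ R of (-1)^(|T\R| + |S|) · 2^(|R| + |R\S|) equals (-1)^(|M ∩ T^c|), which equals (-1)^|M| since M ⊆ T. -/

import Mathlib

open Finset

/-- The sets `S` with `M ⊆ S ⊆ M ∪ R`, for `R` disjoint from `M`, are the sets `M ∪ A` with
`A ⊆ R`. -/
theorem sum_Icc_union_of_disjoint {α β : Type*} [DecidableEq α] [AddCommMonoid β]
    {M R : Finset α} (h : Disjoint M R) (f : Finset α → β) :
    ∑ S ∈ Finset.Icc M (M ∪ R), f S = ∑ A ∈ R.powerset, f (M ∪ A) := by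
  rw [Finset.Icc_eq_image_powerset subset_union_left, union_sdiff_cancel_left h, sum_image]
  intro A hA B hB hAB
  have hA' := h.mono_right (mem_powerset.1 hA)
  have hB' := h.mono_right (mem_powerset.1 hB)
  rw [← union_sdiff_cancel_left hA', ← union_sdiff_cancel_left hB']
  exact congrArg (· \ M) hAB

/-- The binomial expansion of `(2 - 1) ^ #R` over the subsets of `R`. -/
theorem sum_powerset_neg_one_pow_mul_two_pow {α : Type*} [DecidableEq α] (R : Finset α) :
    ∑ A ∈ R.powerset, (-1 : ℤ) ^ A.card * 2 ^ (R \ A).card = 1 := by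
  calc _ = ∑ A ∈ R.powerset, (-1 : ℤ) ^ A.card * 2 ^ (R.card - A.card) :=
        sum_congr rfl fun A hA => by rw [card_sdiff_of_subset (mem_powerset.1 hA)]
    _ = 1 := by rw [sum_pow_mul_eq_add_pow]; norm_num

/-- The binomial expansion of `(2 - 1) ^ #N`, indexed by complements in `N`. -/
theorem sum_powerset_neg_one_pow_sdiff_mul_two_pow {α : Type*} [DecidableEq α] (N : Finset α) :
    ∑ R ∈ N.powerset, (-1 : ℤ) ^ (N \ R).card * 2 ^ R.card = 1 := by
  calc _ = ∑ R ∈ N.powerset, (2 : ℤ) ^ R.card * (-1) ^ (N.card - R.card) :=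
        sum_congr rfl fun R hR => by rw [card_sdiff_of_subset (mem_powerset.1 hR), mul_comm]
    _ = 1 := by rw [sum_pow_mul_eq_add_pow]; norm_num

/-- For subsets `M ⊆ T ⊆ [n]`, the double sum over `R ⊆ T \ M` and `M ⊆ S ⊆ M ∪ R` of
`(-1)^(|T\R| + |S|) · 2^(|R| + |R\S|)` equals `(-1)^(|M ∩ Tᶜ|)` (which is `(-1)^|M|·(-1)^0 = 1`
modulo the convention; stated exactly as the identity with right-hand side `(-1)^(|M ∩ Tᶜ|)`). -/
theorem double_sum_shadow_identity (n : ℕ) (M T : Finset (Fin n)) (hMT : M ⊆ T) :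
    (∑ R ∈ (T \ M).powerset, ∑ S ∈ Finset.Icc M (M ∪ R),
        (-1 : ℤ) ^ ((T \ R).card + S.card) * 2 ^ (R.card + (R \ S).card)) =
      (-1 : ℤ) ^ (M ∩ Tᶜ).card := by
  have hMTc : M ∩ Tᶜ = ∅ := by
    rw [← sdiff_eq_inter_compl, sdiff_eq_empty_iff_subset.2 hMT]
  rw [hMTc, card_empty, pow_zero]
  refine Eq.trans ?_ (sum_powerset_neg_one_pow_sdiff_mul_two_pow (T \ M))
  refine sum_congr rfl fun R hR => ?_
  have hRN := mem_powerset.1 hR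
  have hMR : Disjoint M R := disjoint_sdiff.mono_right hRN
  have hTR : (T \ R).card = M.card + ((T \ M) \ R).card := by
    rw [← card_union_of_disjoint (disjoint_sdiff.mono_right sdiff_subset)]
    congr 1
    ext x
    have hxT : x ∈ M → x ∈ T := fun hx => hMT hx
    have hxR : x ∈ M → x ∉ R := fun hx => disjoint_left.1 hMR hx
    simp only [mem_sdiff, mem_union]
    tauto
  rw [sum_Icc_union_of_disjoint hMR]
  refine Eq.trans ?_ ((congrArg _ (sum_powerset_neg_one_pow_mul_two_pow R)).trans (mul_one _))
  rw [mul_sum]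
  refine sum_congr rfl fun A hA => ?_
  have hMA := hMR.mono_right (mem_powerset.1 hA)
  have hRA : R \ (M ∪ A) = R \ A := by
    rw [← sup_eq_union, ← _root_.sdiff_sdiff_left, sdiff_eq_self_of_disjoint hMR.symm]
  have hsq : (-1 : ℤ) ^ M.card * (-1) ^ M.card = 1 := by
    rw [← mul_pow]; norm_num
  rw [hTR, card_union_of_disjoint hMA, hRA]
  simp only [pow_add]
  linear_combination ((-1 : ℤ) ^ ((T \ M) \ R).card * (-1) ^ A.card * 2 ^ R.card *
    2 ^ (R \ A).card) * hsq
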